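/- Commutation relations for cubic 3-constellation operators: for all integers i, j ≥ 1 and all 0 ≤ s, s' ≤ 3, the following hold (all sums over l ≥ 1 being locally finite): (a) [A_i(s), A_j(s)] = Σ_{l≥1} D_{ij,l}(s) ∘ A_l(s); (b) [A_i(s), A_j(s')] − [A_j(s), A_i(s')] = Σ_{l≥1} ( D_{ij,l}(s') ∘ A_l(s) + D_{ij,l}(s) ∘ A_l(s') ); (c) [p_i^*, A_j(s)] − [p_j^*, A_i(s)] = Σ_{l≥1} D_{ij,l}(s) ∘ p_l^*. -/

import Mathlib

noncomputable section

/-- The polynomial ring `K[p₁, p₂, …]`, with one variable `p_i` for each positive integer. -/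
abbrev Rp (K : Type) [Field K] : Type := MvPolynomial ℕ+ K

/-- The partial derivative `∂/∂p_i` as a `K`-linear endomorphism (junk value `0` for `i = 0`). -/
def pderivN (K : Type) [Field K] (i : ℕ) : Module.End K (Rp K) :=
  if h : 0 < i then (MvPolynomial.pderiv (⟨i, h⟩ : ℕ+)).toLinearMap else 0

/-- Multiplication by the variable `p_i` (junk value `0` for `i = 0`). -/
def mulpN (K : Type) [Field K] (i : ℕ) : Module.End K (Rp K) :=
  if h : 0 < i then LinearMap.mulLeft K (MvPolynomial.X (⟨i, h⟩ : ℕ+)) else 0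

/-- The operator `p_i^* = i·∂/∂p_i`. -/
def pstar (K : Type) [Field K] (i : ℕ) : Module.End K (Rp K) :=
  (i : K) • pderivN K i

/-- The current operators: `J_{−k}` is multiplication by `p_k` and `J_k = (1+b)·k·∂/∂p_k`
for `k ≥ 1`, and `J₀ = 0`. -/
def Jop (K : Type) [Field K] (b : K) (m : ℤ) : Module.End K (Rp K) :=
  if 0 < m then ((1 + b) * (m : K)) • pderivN K m.toNat else mulpN K (-m).toNat

/-- The structure operators `D_{ij,l}(s)` of the cubic `3`-constellation model, `0 ≤ s ≤ 3`:
`D_{ij,l}(0) = D_{ij,l}(1) = 0`, `D_{ij,l}(2) = (i−j)·δ_{l,i+j−1}·id` and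
`D_{ij,l}(3) = (i−j)(2[l ≥ M] + [M ≤ l ≤ i+j−1])·J_{i+j−1−l}
  + sgn(i−j)(2l−3μ+1)[μ ≤ l ≤ M−1]·J_{i+j−1−l} + b(i−j)(i+j−2)·δ_{l,i+j−1}·id`,
where `μ = min(i,j)`, `M = max(i,j)`. -/
def Dcoef (K : Type) [Field K] (b : K) (i j l : ℕ) : ℕ → Module.End K (Rp K)
  | 2 => if (l : ℤ) = (i : ℤ) + (j : ℤ) - 1 then
      ((i : K) - (j : K)) • (1 : Module.End K (Rp K)) else 0
  | 3 =>
      (((i : K) - (j : K)) *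
          (2 * (if max i j ≤ l then (1 : K) else 0) +
            (if max i j ≤ l ∧ (l : ℤ) ≤ (i : ℤ) + (j : ℤ) - 1 then (1 : K) else 0)) +
        ((((i : ℤ) - (j : ℤ)).sign : K) *
            ((2 * (l : ℤ) - 3 * (min i j : ℤ) + 1 : ℤ) : K)) *
          (if min i j ≤ l ∧ l < max i j then (1 : K) else 0)) •
        Jop K b ((i : ℤ) + (j : ℤ) - 1 - (l : ℤ)) +
      (b * ((i : K) - (j : K)) * ((i : K) + (j : K) - 2)) •
        (if (l : ℤ) = (i : ℤ) + (j : ℤ) - 1 then (1 : Module.End K (Rp K)) else 0)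
  | _ => 0

theorem HasSum.int_shift {V : Type*} [AddCommMonoid V] [TopologicalSpace V] {g h : ℤ → V} {v : V}
    (hg : HasSum g v) (c : ℤ)
    (hgh : ∀ n, h n = g (n + c)) : HasSum h v := by
  rw [funext hgh]
  exact (Equiv.addRight c).hasSum_iff.2 hg

theorem HasSum.int_reflect {V : Type*} [AddCommMonoid V] [TopologicalSpace V] {g h : ℤ → V} {v : V}
    (hg : HasSum g v) (c : ℤ)
    (hgh : ∀ n, h n = g (c - n)) : HasSum h v := by
  rw [funext hgh]
  exact (Equiv.subLeft c).hasSum_iff.2 hg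

theorem HasSum.prod_fiberwise_right {ι κ V : Type*} [AddCommMonoid V] [TopologicalSpace V]
    [ContinuousAdd V] [RegularSpace V] {F : ι × κ → V} {g : κ → V} {v : V} (hF : HasSum F v)
    (h : ∀ y, HasSum (fun x => F (x, y)) (g y)) : HasSum g v :=
  ((Equiv.prodComm κ ι).hasSum_iff.2 hF).prod_fiberwise h

theorem eq_zero_of_hasSum_antisymm {K V : Type*} [Field K] [CharZero K] [AddCommGroup V]
    [Module K V] [TopologicalSpace V] [DiscreteTopology V] {g : ℤ → V} {v : V} (hg : HasSum g v)
    (c : ℤ) (h : ∀ n, g n = -g (c - n)) : v = 0 := by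
  have h1 : v = -v := hg.unique (HasSum.int_reflect hg.neg c h)
  have h2 : (2 : K) • v = 0 := by
    rw [two_smul]
    nth_rewrite 1 [h1]
    exact neg_add_cancel v
  exact (smul_eq_zero.1 h2).resolve_left two_ne_zero

section Constellation

variable {K V : Type*} [Field K] [AddCommGroup V] [Module K V] [TopologicalSpace V]
  [DiscreteTopology V]

theorem HasSum.map_end {ι : Type*} {g : ι → V} {v : V} (h : HasSum g v) (T : Module.End K V) :
    HasSum (fun n => T (g n)) (T v) :=
  h.map T continuous_of_discreteTopology

theorem HasSum.smul_discrete {ι : Type*} {g : ι → V} {v : V} (h : HasSum g v) (c : K) :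
    HasSum (fun n => c • g n) (c • v) :=
  h.map_end (LinearMap.lsmul K V c)

/-- A family of operators `a s i` built from a Heisenberg algebra `J` (with central charge `β`)
by the recursion `a (s + 1) i = ∑ n, J (i - n) ∘ a s n + b (i - 1) a s i`, starting from the first
basis vector.  Infinite sums are taken pointwise, in the discrete topology. -/
structure IsConstellation (β b : K) (J : ℤ → Module.End K V)
    (a : ℕ → ℤ → Module.End K V) : Prop where
  charge_ne_zero : β ≠ 0
  J_zero : J 0 = 0
  J_comm : ∀ m n f, J m (J n f) = J n (J m f) + if m + n = 0 then (β * m) • f else 0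
  J_eventually : ∀ f, ∀ᶠ k in Filter.atTop, J k f = 0
  a_nonpos : ∀ s i, i ≤ 0 → a s i = 0
  a_zero_one : ∀ f, β • a 0 1 f = f
  a_zero : ∀ i, i ≠ 1 → a 0 i = 0
  a_succ : ∀ s i f, 1 ≤ i →
    HasSum (fun n => J (i - n) (a s n f)) (a (s + 1) i f - (b * (i - 1)) • a s i f)

namespace IsConstellation

variable {β b : K} {J : ℤ → Module.End K V} {a : ℕ → ℤ → Module.End K V}

theorem a_eventually (S : IsConstellation β b J a) (s : ℕ) (f : V) :
    ∀ᶠ i in Filter.atTop, a s i f = 0 := by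
  induction s with
  | zero =>
    filter_upwards [Filter.eventually_ge_atTop 2] with i hi
    rw [S.a_zero i (by omega)]; rfl
  | succ s ih =>
    obtain ⟨N, hN⟩ := Filter.eventually_atTop.1 ih
    have h : ∀ n ∈ Finset.Ico 1 N, ∀ᶠ i in Filter.atTop, J (i - n) (a s n f) = 0 := by
      intro n _
      exact (Filter.tendsto_atTop_add_const_right _ (-n) Filter.tendsto_id).eventually
        (S.J_eventually (a s n f))
    rw [← Filter.eventually_all_finset] at h
    filter_upwards [h, Filter.eventually_ge_atTop N, Filter.eventually_ge_atTop 1] with i hi hiN hi1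
    have h0 : (fun n => J (i - n) (a s n f)) = fun _ => 0 := by
      funext n
      by_cases h1 : n ≤ 0
      · simp [S.a_nonpos s n h1]
      · by_cases h2 : N ≤ n
        · simp [hN n h2]
        · exact hi n (Finset.mem_Ico.2 ⟨by omega, by omega⟩)
    have h3 := S.a_succ s i f hi1
    rw [h0] at h3
    have h4 := h3.unique hasSum_zero
    rw [hN i hiN, smul_zero, sub_zero] at h4
    exact h4

/-- Any sum of terms `T q (a s q f)` has finitely many nonzero terms. -/
theorem summable_a (S : IsConstellation β b J a) (s : ℕ) (T : ℤ → Module.End K V) (f : V) :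
    Summable fun q => T q (a s q f) := by
  obtain ⟨N, hN⟩ := Filter.eventually_atTop.1 (S.a_eventually s f)
  refine (hasSum_sum_of_ne_finset_zero (s := Finset.Ico 1 N) fun q hq => ?_).summable
  rw [Finset.mem_Ico] at hq
  by_cases h1 : q ≤ 0
  · simp [S.a_nonpos s q h1]
  · simp [hN q (by omega)]

theorem hasSum_single_coeff (S : IsConstellation β b J a) (s : ℕ) (N : ℤ) (c : ℤ → ℤ) (f : V) :
    ∃ v, HasSum (fun q => (c q : K) • J (N - q) (a s q f)) v :=
  S.summable_a s (fun q => (c q : K) • J (N - q)) f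

/-- The quadratic sums in `J` applied to `a s q f` are finite as soon as the left index is
bounded above. -/
theorem hasSum_double_coeff (S : IsConstellation β b J a) (s : ℕ) (N X : ℤ) (c : ℤ → ℤ → ℤ)
    (hc : ∀ x q, X < x → c x q = 0) (f : V) :
    ∃ v, HasSum (fun p : ℤ × ℤ => (c p.1 p.2 : K) • J p.1 (J (N - p.2 - p.1) (a s p.2 f))) v := by
  obtain ⟨Q, hQ⟩ := Filter.eventually_atTop.1 (S.a_eventually s f)
  have h : ∀ᶠ k in Filter.atTop, ∀ q ∈ Finset.Ico 1 Q, J k (a s q f) = 0 := by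
    rw [Filter.eventually_all_finset]
    exact fun q _ => S.J_eventually _
  obtain ⟨Y, hY⟩ := Filter.eventually_atTop.1 h
  refine (hasSum_sum_of_ne_finset_zero
    (s := Finset.Icc (N - Q - Y) X ×ˢ Finset.Ico 1 Q) fun p hp => ?_).summable
  rw [Finset.mem_product, Finset.mem_Icc, Finset.mem_Ico] at hp
  by_cases h1 : p.2 ≤ 0
  · simp [S.a_nonpos s p.2 h1]
  by_cases h2 : Q ≤ p.2
  · simp [hQ _ h2]
  by_cases h3 : X < p.1
  · simp [hc _ _ h3]
  rw [hY _ (by omega) p.2 (Finset.mem_Ico.2 ⟨by omega, by omega⟩)]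
  simp

theorem smul_a_one (S : IsConstellation β b J a) {i : ℤ} (hi : 1 ≤ i) (f : V) :
    β • a 1 i f = J (i - 1) f := by
  have h := (S.a_succ 0 i f hi).smul_discrete β
  have h1 := hasSum_single (f := fun n => β • J (i - n) (a 0 n f)) 1 (fun n hn => by
    simp [S.a_zero n hn])
  have h2 := h.unique h1
  simp only [zero_add] at h2
  rw [← map_smul (J (i - 1)), S.a_zero_one] at h2
  rw [← h2]
  by_cases h3 : i = 1
  · subst h3; simp
  · simp [S.a_zero i h3]

theorem a_one (S : IsConstellation β b J a) {i : ℤ} (hi : 1 ≤ i) (f : V) :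
    a 1 i f = β⁻¹ • J (i - 1) f := by
  rw [← S.smul_a_one hi, smul_smul, inv_mul_cancel₀ S.charge_ne_zero, one_smul]

/-- The second level, expressed through the Heisenberg algebra only. -/
theorem hasSum_a_two (S : IsConstellation β b J a) (m : ℤ) (hm : 1 ≤ m) (f : V) :
    HasSum (fun x => ((if x ≤ m - 1 then 1 else 0 : ℤ) : K) • J x (J (m - 1 - x) f))
      (β • a 2 m f - (b * (m - 1)) • J (m - 1) f) := by
  have h := (S.a_succ 1 m f hm).smul_discrete β
  rw [smul_sub, smul_comm, S.smul_a_one hm] at h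
  refine h.int_reflect m fun x => ?_
  rw [sub_sub_cancel]
  by_cases hx : x ≤ m - 1
  · rw [if_pos hx, ← map_smul (J x) β, S.smul_a_one (by omega), sub_right_comm]
    simp
  · simp [hx, S.a_nonpos 1 (m - x) (by omega)]

theorem hasSum_comm_succ (S : IsConstellation β b J a) (T : Module.End K V) (s : ℕ) {i : ℤ}
    (hi : 1 ≤ i) (f : V) :
    HasSum (fun n => T (J (i - n) (a s n f)) - J (i - n) (a s n (T f)))
      (T (a (s + 1) i f) - a (s + 1) i (T f)
        - (b * (i - 1)) • (T (a s i f) - a s i (T f))) := by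
  have h := ((S.a_succ s i f hi).map_end T).sub (S.a_succ s i (T f) hi)
  convert h using 1
  rw [map_sub, map_smul]
  module

theorem J_a_one (S : IsConstellation β b J a) (k : ℤ) {j : ℤ} (hj : 1 ≤ j) (f : V) :
    J k (a 1 j f) = a 1 j (J k f) + if k = 1 - j then (k : K) • f else 0 := by
  rw [S.a_one hj, S.a_one hj, map_smul, S.J_comm, smul_add]
  congr 1
  by_cases h : k = 1 - j
  · rw [if_pos (by omega), if_pos h, smul_smul, inv_mul_cancel_left₀ S.charge_ne_zero]
  · rw [if_neg (by omega), if_neg h, smul_zero]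

theorem J_a_two (S : IsConstellation β b J a) (k : ℤ) {j : ℤ} (hj : 1 ≤ j) (f : V) :
    J k (a 2 j f) = a 2 j (J k f)
      + ((k * ((if 1 ≤ j + k then 1 else 0) + if k ≤ 0 then 1 else 0) : ℤ) : K) • J (j + k - 1) f
      + if k = 1 - j then (b * (j - 1) * k : K) • f else 0 := by
  have h := S.hasSum_comm_succ (J k) 1 hj f
  have h1 : HasSum (fun n => (if n = j + k then (β * k) • a 1 (j + k) f else 0)
      + if n = 1 - k then (if k ≤ 0 then (k : K) • J (j + k - 1) f else 0) else 0)
      ((β * k) • a 1 (j + k) f + if k ≤ 0 then (k : K) • J (j + k - 1) f else 0) :=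
    (hasSum_ite_eq _ _).add (hasSum_ite_eq _ _)
  have h2 : ∀ n, J k (J (j - n) (a 1 n f)) - J (j - n) (a 1 n (J k f)) =
      (if n = j + k then (β * k) • a 1 (j + k) f else 0)
      + if n = 1 - k then (if k ≤ 0 then (k : K) • J (j + k - 1) f else 0) else 0 := by
    intro n
    by_cases hn : n ≤ 0
    · by_cases h3 : n = j + k
      · subst h3
        simp [S.a_nonpos 1 (j + k) hn]
        intros; omega
      · simp [S.a_nonpos 1 n hn, h3]
        intros; omega
    · rw [S.J_comm, S.J_a_one k (by omega), map_add]
      have e1 : (if k + (j - n) = 0 then (β * k) • a 1 n f else 0) =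
          if n = j + k then (β * k) • a 1 (j + k) f else 0 := by
        by_cases h3 : n = j + k
        · subst h3; simp
        · rw [if_neg (by omega), if_neg h3]
      have e2 : J (j - n) (if k = 1 - n then (k : K) • f else 0) =
          if n = 1 - k then (if k ≤ 0 then (k : K) • J (j + k - 1) f else 0) else 0 := by
        by_cases h3 : n = 1 - k
        · subst h3
          rw [if_pos (by omega), if_pos rfl, if_pos (by omega), map_smul,
            show j - (1 - k) = j + k - 1 by ring]
        · rw [if_neg (by omega), if_neg h3, map_zero]
      rw [e1, e2]
      abel
  simp only [h2] at h
  have h3 := h.unique h1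
  rw [S.J_a_one k hj] at h3
  have e1 : (β * k) • a 1 (j + k) f =
      (k : K) • ((if 1 ≤ j + k then 1 else 0 : ℤ) : K) • J (j + k - 1) f := by
    by_cases h4 : 1 ≤ j + k
    · rw [if_pos h4, ← S.smul_a_one h4]; push_cast; module
    · rw [if_neg h4, S.a_nonpos 1 (j + k) (by omega)]; simp
  rw [e1] at h3
  have e2 : (if k = 1 - j then (b * (j - 1) * k : K) • f else 0) =
      (b * (j - 1)) • if k = 1 - j then (k : K) • f else 0 := by
    split_ifs <;> module
  have e3 : (if k ≤ 0 then (k : K) • J (j + k - 1) f else 0) =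
      (k : K) • ((if k ≤ 0 then 1 else 0 : ℤ) : K) • J (j + k - 1) f := by
    split_ifs <;> simp
  rw [e2]
  rw [e3] at h3
  push_cast [-Int.cast_ite] at h3 ⊢
  linear_combination (norm := module) h3

theorem hasSum_J_a_three (S : IsConstellation β b J a) (k : ℤ) {j : ℤ} (hj : 1 ≤ j) (f : V) :
    HasSum (fun x => ((if x ≤ j - 1 then
        k * ((if 1 ≤ j - x + k then 1 else 0) + if k ≤ 0 then 1 else 0) else 0 : ℤ) : K) •
          J x (J (j + k - 1 - x) f))
      (J k (a 3 j f) - a 3 j (J k f) - (β * k) • a 2 (j + k) f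
        - (b * (((j - 1) * k * ((if 1 ≤ j + k then 1 else 0) + if k ≤ 0 then 1 else 0)
            - k * k * if k ≤ 0 then 1 else 0 : ℤ) : K)) • J (j + k - 1) f
        - if k = 1 - j then (b * b * (j - 1) ^ 2 * k) • f else 0) := by
  have h := S.hasSum_comm_succ (J k) 2 hj f
  have h1 : HasSum (fun n => (if n = j + k then (β * k) • a 2 (j + k) f else 0)
      + if n = 1 - k then (if k ≤ 0 then (-(b * k * k)) • J (j + k - 1) f else 0) else 0)
      ((β * k) • a 2 (j + k) f + if k ≤ 0 then (-(b * k * k)) • J (j + k - 1) f else 0) :=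
    (hasSum_ite_eq _ _).add (hasSum_ite_eq _ _)
  have h2 := h.sub h1
  convert (h2.int_reflect j fun x => rfl) using 1
  · funext x
    rw [sub_sub_cancel]
    by_cases hx : x ≤ j - 1
    · rw [if_pos hx, S.J_comm k x, S.J_a_two k (by omega), map_add, map_add, map_smul,
        show j - x + k - 1 = j + k - 1 - x by ring]
      have e1 : (if k + x = 0 then (β * k) • a 2 (j - x) f else 0) =
          if j - x = j + k then (β * k) • a 2 (j + k) f else 0 := by
        by_cases h3 : j - x = j + k
        · rw [if_pos h3, if_pos (by omega), h3]
        · rw [if_neg (by omega), if_neg h3]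
      have e2 : J x (if k = 1 - (j - x) then (b * (((j - x : ℤ) : K) - 1) * k) • f else 0) =
          if j - x = 1 - k then (if k ≤ 0 then (-(b * k * k)) • J (j + k - 1) f else 0)
            else 0 := by
        by_cases h3 : j - x = 1 - k
        · rw [if_pos (by omega), if_pos h3, if_pos (by omega), map_smul, h3,
            show x = j + k - 1 by omega]
          push_cast
          module
        · rw [if_neg (by omega), if_neg h3, map_zero]
      rw [e1, e2]
      module
    · have h3 : ¬ (j - x = 1 - k ∧ k ≤ 0) := by omega
      rw [if_neg hx, S.a_nonpos 2 (j - x) (by omega)]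
      by_cases h4 : j - x = j + k
      · rw [if_pos h4, S.a_nonpos 2 (j + k) (by omega)]
        simp
        intros; omega
      · simp [h4]
        intros; omega
  · rw [S.J_a_two k hj]
    have e2 : (if k = 1 - j then (b * b * (j - 1) ^ 2 * k : K) • f else 0) =
        (b * (j - 1)) • if k = 1 - j then (b * (j - 1) * k : K) • f else 0 := by
      split_ifs <;> module
    have e3 : (if k ≤ 0 then (-(b * k * k)) • J (j + k - 1) f else 0) =
        (-(b * k * k)) • ((if k ≤ 0 then 1 else 0 : ℤ) : K) • J (j + k - 1) f := by
      split_ifs <;> simp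
    rw [e2, e3]
    push_cast [-Int.cast_ite]
    module

/-- If the commutator of level `s` with level two is a multiple of level `s`, then the commutator
of level `s + 1` with level two is an explicit linear sum over level `s`. -/
theorem hasSum_comm_a_two (S : IsConstellation β b J a) (s : ℕ) {i j : ℤ} (hi : 1 ≤ i)
    (hj : 1 ≤ j) (f : V) (r : ℤ → ℤ)
    (H : ∀ n, 1 ≤ n → a s n (a 2 j f) - a 2 j (a s n f) = (r n : K) • a s (n + j - 1) f) :
    HasSum (fun q => (((if j ≤ q then r (q - j + 1) else 0) +
        (i - q) * ((if q ≤ i + j - 1 then 1 else 0) + if i ≤ q then 1 else 0) : ℤ) : K) •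
          J (i + j - 1 - q) (a s q f))
      (a (s + 1) i (a 2 j f) - a 2 j (a (s + 1) i f)
        - (b * (((i - 1) * r i - (j - 1) ^ 2 : ℤ) : K)) • a s (i + j - 1) f) := by
  have h := S.hasSum_comm_succ (a 2 j) s hi f
  obtain ⟨v1, h1⟩ := S.hasSum_single_coeff s (i + j - 1)
    (fun q => if j ≤ q then r (q - j + 1) else 0) f
  obtain ⟨v2, h2⟩ := S.hasSum_single_coeff s (i + j - 1)
    (fun q => (i - q) * ((if q ≤ i + j - 1 then 1 else 0) + if i ≤ q then 1 else 0)) f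
  have h3 : HasSum (fun n => if n = i + j - 1 then (-(b * (j - 1) ^ 2)) • a s (i + j - 1) f else 0)
      _ := hasSum_ite_eq _ _
  have h1' : HasSum (fun n => ((if 1 ≤ n then r n else 0 : ℤ) : K) •
      J (i - n) (a s (n + j - 1) f)) v1 := by
    refine h1.int_shift (j - 1) fun n => ?_
    rw [show n + (j - 1) - j + 1 = n by ring, show i + j - 1 - (n + (j - 1)) = i - n by ring,
      show n + (j - 1) = n + j - 1 by ring, if_congr (by omega : j ≤ n + j - 1 ↔ 1 ≤ n) rfl rfl]
  have h4 := ((h.add h1').add h2).add h3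
  have h5 := h1.add h2
  have h6 := h4.unique (a₂ := 0) (by
    convert hasSum_zero with n
    by_cases hn : n ≤ 0
    · rw [if_neg (by omega : ¬ 1 ≤ n), if_neg (by omega : ¬ n = i + j - 1),
        S.a_nonpos s n hn]
      simp
    have h7 := S.J_a_two (i - n) hj (a s n f)
    have h8 := congrArg (J (i - n)) (H n (by omega))
    rw [map_sub, map_smul] at h8
    rw [if_pos (by omega : 1 ≤ n)]
    have e1 : (if i - n = 1 - j then (b * (j - 1) * ((i - n : ℤ) : K)) • a s n f else 0) =
        if n = i + j - 1 then (-(b * (j - 1) ^ 2)) • a s (i + j - 1) f else 0 := by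
      by_cases h9 : n = i + j - 1
      · rw [if_pos (by omega), if_pos h9, h9]
        push_cast
        module
      · rw [if_neg (by omega), if_neg h9]
    have e2 : (if 1 ≤ j + (i - n) then 1 else 0 : ℤ) = if n ≤ i + j - 1 then 1 else 0 :=
      if_congr (by omega) rfl rfl
    have e3 : (if i - n ≤ 0 then 1 else 0 : ℤ) = if i ≤ n then 1 else 0 :=
      if_congr (by omega) rfl rfl
    rw [e1, e2, e3, show j + (i - n) - 1 = i + j - 1 - n by ring] at h7
    linear_combination (norm := module) -h7 - h8)
  convert h5 using 1
  · funext q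
    push_cast [-Int.cast_ite]
    module
  · have h7 := H i hi
    rw [← sub_eq_zero] at h6
    push_cast
    linear_combination (norm := module) -h6 + (b * ((i : K) - 1)) • h7

theorem comm_a_one_a_two (S : IsConstellation β b J a) {i j : ℤ} (hi : 1 ≤ i) (hj : 1 ≤ j)
    (f : V) :
    a 1 i (a 2 j f) - a 2 j (a 1 i f) = ((i - 1 : ℤ) : K) • a 1 (i + j - 1) f := by
  rw [S.a_one hi, S.a_one hi, S.a_one (by omega), S.J_a_two (i - 1) hj, map_smul,
    show j + (i - 1) - 1 = i + j - 1 - 1 by ring, if_pos (by omega : 1 ≤ j + (i - 1))]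
  by_cases h : i = 1
  · subst h; simp
  · rw [if_neg (by omega), if_neg (by omega)]
    push_cast
    module

/-- The operators of level two satisfy the Witt relations. -/
theorem comm_a_two_a_two [CharZero K] (S : IsConstellation β b J a) {i j : ℤ} (hi : 1 ≤ i)
    (hj : 1 ≤ j) (f : V) :
    a 2 i (a 2 j f) - a 2 j (a 2 i f) = ((i - j : ℤ) : K) • a 2 (i + j - 1) f := by
  have h1 := S.hasSum_comm_a_two 1 hi hj f (fun n => n - 1)
    fun n hn => S.comm_a_one_a_two hn hj f
  have h2 := (S.a_succ 1 (i + j - 1) f (by omega)).smul_discrete ((i - j : ℤ) : K)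
  have h3 := eq_zero_of_hasSum_antisymm (K := K) (h1.sub h2) (i + j) fun q => by
    have e1 : q ≤ i + j - 1 → q ≥ 1 → J (i + j - 1 - (i + j - q)) (a 1 (i + j - q) f) =
        J (i + j - 1 - q) (a 1 q f) := by
      intro hq hq1
      rw [S.a_one hq1, S.a_one (by omega), map_smul, map_smul, S.J_comm,
        show i + j - 1 - (i + j - q) = q - 1 by ring, show i + j - q - 1 = i + j - 1 - q by ring]
      by_cases h : q - 1 + (i + j - 1 - q) = 0
      · rw [if_pos h, show q - 1 = 0 by omega]; simp
      · rw [if_neg h, add_zero]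
    rw [← sub_smul, ← sub_smul, ← Int.cast_sub, ← Int.cast_sub]
    by_cases hq : q ≤ 0
    · rw [S.a_nonpos 1 q hq]
      have : ∀ c : ℤ, c = 0 → (0 : V) = (c : K) • J (i + j - 1 - (i + j - q)) (a 1 (i + j - q) f) := by
        rintro c rfl; simp
      simp only [LinearMap.zero_apply, map_zero, smul_zero, zero_eq_neg]
      refine (this _ ?_).symm
      split_ifs <;> omega
    by_cases hq2 : i + j - 1 < q
    · rw [S.a_nonpos 1 (i + j - q) (by omega)]
      have : ∀ c : ℤ, c = 0 → (c : K) • J (i + j - 1 - q) (a 1 q f) = 0 := by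
        rintro c rfl; simp
      simp only [LinearMap.zero_apply, map_zero, smul_zero, neg_zero]
      refine this _ ?_
      split_ifs <;> omega
    rw [e1 (by omega) (by omega), ← neg_smul, ← Int.cast_neg]
    congr 2
    split_ifs <;> omega
  push_cast at h3 ⊢
  linear_combination (norm := module) h3

/-- A double sum with antisymmetric coefficients reduces to the central terms. -/
theorem hasSum_central_of_antisymm [CharZero K] (S : IsConstellation β b J a) (s : ℕ) (N X : ℤ)
    (c : ℤ → ℤ → ℤ) (hX : ∀ x q, X < x → c x q = 0)
    (hc : ∀ x q, 1 ≤ q → x ≠ 0 → N - q - x ≠ 0 → c x q + c (N - q - x) q = 0) (hN : 1 ≤ N)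
    (f : V) {v : V}
    (hv : HasSum (fun p : ℤ × ℤ => (c p.1 p.2 : K) • J p.1 (J (N - p.2 - p.1) (a s p.2 f))) v) :
    HasSum (fun x => if 0 < x then (β * x * c x N) • a s N f else 0) v := by
  obtain ⟨v1, h1⟩ := S.hasSum_double_coeff s N X
    (fun x q => if N - q - x < x then c x q else 0) (fun x q h => by simp [hX x q h]) f
  obtain ⟨v2, h2⟩ := S.hasSum_double_coeff s N X
    (fun x q => if x < N - q - x then c x q else 0) (fun x q h => by simp [hX x q h]) f
  have hr : Function.Involutive fun p : ℤ × ℤ => (N - p.2 - p.1, p.2) := by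
    rintro ⟨x, q⟩; simp
  have h1' := (hr.toPerm _).hasSum_iff.2 h1
  have hq : ∀ p : ℤ × ℤ, 1 ≤ p.2 ∨ a s p.2 = 0 := fun p => by
    by_cases h : 1 ≤ p.2
    · exact .inl h
    · exact .inr (S.a_nonpos s _ (by omega))
  have h0 : ∀ x q (T : Module.End K V) (g : V), 1 ≤ q → x = 0 ∨ N - q - x = 0 →
      J x (J (N - q - x) g) = 0 ∧ J (N - q - x) (J x g) = 0 := by
    rintro x q T g h (h | h) <;> simp [h, S.J_zero]
  have hv2 : v = v1 + v2 := by
    refine hv.unique ?_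
    convert h1.add h2 using 2 with p
    obtain ⟨x, q⟩ := p
    dsimp only
    rw [← add_smul, ← Int.cast_add]
    rcases hq (x, q) with h | h
    · by_cases hx : x = 0 ∨ N - q - x = 0
      · simp [(h0 x q 0 (a s q f) h hx).1]
      · congr 2
        have := hc x q h (by tauto) (by tauto)
        rcases lt_trichotomy x (N - q - x) with h3 | h3 | h3
        · rw [if_neg (by omega), if_pos h3, zero_add]
        · rw [← h3] at this ⊢; simp; omega
        · rw [if_pos h3, if_neg (by omega), add_zero]
    · simp only at h
      simp [h]
  have h3 : HasSum (fun p : ℤ × ℤ => if p.2 = N ∧ p.1 < 0 then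
      (β * -p.1 * c (-p.1) N) • a s N f else 0) v := by
    rw [hv2]
    convert h1'.add h2 using 2 with p
    obtain ⟨x, q⟩ := p
    simp only [Function.comp, Function.Involutive.coe_toPerm, sub_sub_cancel]
    rcases hq (x, q) with h | h
    · by_cases hx : x = 0 ∨ N - q - x = 0
      · rw [(h0 x q 0 (a s q f) h hx).1, (h0 x q 0 (a s q f) h hx).2, smul_zero, smul_zero,
          add_zero]
        simp only at h
        rw [if_neg (by omega)]
      · have h4 := hc x q h (by tauto) (by tauto)
        have h5 : c x q = -c (N - q - x) q := by omega
        rw [S.J_comm (N - q - x) x]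
        by_cases h6 : x < N - q - x
        · by_cases h7 : q = N
          · subst h7
            rw [if_pos h6, if_pos h6, if_pos (by omega), if_pos (by omega), h5, sub_self, zero_sub]
            push_cast
            module
          · rw [if_pos h6, if_pos h6, if_neg (by omega), if_neg (by omega), h5]
            push_cast
            module
        · rw [if_neg h6, if_neg h6, if_neg (by omega)]
          simp
    · simp only at h
      by_cases h6 : q = N
      · rw [h6] at h
        simp [h6, h]
      · simp [h, h6]
  have hi : Function.Injective fun x : ℤ => ((-x, N) : ℤ × ℤ) := fun x y h => by simpa using h
  rw [← hi.hasSum_iff] at h3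
  · convert h3 using 2 with x
    simp
  · rintro ⟨x, q⟩ hx
    rw [if_neg]
    rintro ⟨rfl, -⟩
    exact hx ⟨-x, by simp⟩

/-- The scalar part of the structure operators of the cubic model. -/
def structureCoeff (i j l : ℤ) : ℤ :=
  (i - j) * (2 * (if max i j ≤ l then 1 else 0) + if max i j ≤ l ∧ l ≤ i + j - 1 then 1 else 0) +
    (i - j).sign * (2 * l - 3 * min i j + 1) * if min i j ≤ l ∧ l < max i j then 1 else 0

theorem structureCoeff_of_lt {i j : ℤ} (h : j < i) (l : ℤ) : structureCoeff i j l =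
    if l < j then 0 else if l < i then 2 * l - 3 * j + 1 else
      if l ≤ i + j - 1 then 3 * (i - j) else 2 * (i - j) := by
  rw [structureCoeff, max_eq_left h.le, min_eq_right h.le, Int.sign_eq_one_of_pos (by omega)]
  split_ifs <;> omega

theorem structureCoeff_symm (i j l : ℤ) : structureCoeff j i l = -structureCoeff i j l := by
  rw [structureCoeff, structureCoeff, max_comm j i, min_comm j i, add_comm j i, ← neg_sub i j,
    Int.sign_neg]
  ring

theorem hasSum_J_comm_a_three_a_two [CharZero K] (S : IsConstellation β b J a) {i j : ℤ}
    (hj : 1 ≤ j) (f : V) {v w : V}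
    (hv : HasSum (fun p : ℤ × ℤ => ((if p.1 ≤ i - 1 then (if i - p.1 ≤ p.2 then
        p.2 - (i - p.1) + 1 - (i - p.1) else 0) + (j - p.2) *
          ((if p.2 ≤ j + (i - p.1) - 1 then 1 else 0) + if j ≤ p.2 then 1 else 0) else 0 : ℤ) : K) •
        J p.1 (J (i + j - 1 - p.2 - p.1) (a 2 p.2 f))) v)
    (hw : HasSum (fun q => ((if j ≤ q then (j - 1) * (2 * j - q - 1) - (q - j) ^ 2 else 0 : ℤ) : K) •
        J (i + j - 1 - q) (a 2 q f)) w) :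
    HasSum (fun n => J (i - n) (a 3 j (a 2 n f) - a 2 n (a 3 j f))) (v + b • w) := by
  have h1 := hv.prod_fiberwise (g := fun x => if x ≤ i - 1 then
      J x (a 3 j (a 2 (i - x) f) - a 2 (i - x) (a 3 j f)
        - (b * (((j - 1) * (j - (i - x)) - (i - x - 1) ^ 2 : ℤ) : K)) • a 2 (j + (i - x) - 1) f)
        else 0) (fun x => by
    by_cases hx : x ≤ i - 1
    · have h := (S.hasSum_comm_a_two 2 hj (by omega : 1 ≤ i - x) f (fun m => m - (i - x))
        fun m hm => S.comm_a_two_a_two hm (by omega) f).map_end (J x)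
      simp only [hx, if_true]
      convert h using 2 with q
      rw [map_smul, show i + j - 1 - q - x = j + (i - x) - 1 - q by ring]
    · simp [hx])
  have h2 := (hw.smul_discrete b).int_reflect (i + j - 1)
    (h := fun x => (b * ((if x ≤ i - 1 then
      (j - 1) * (j - (i - x)) - (i - x - 1) ^ 2 else 0 : ℤ) : K)) • J x (a 2 (i + j - 1 - x) f))
    fun x => by
      rw [smul_smul, sub_sub_cancel]
      congr 3
      simp only [(by omega : j ≤ i + j - 1 - x ↔ x ≤ i - 1)]
      split_ifs <;> ring
  refine (h1.add h2).int_reflect i fun n => ?_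
  by_cases hn : 1 ≤ n
  · rw [if_pos (by omega), if_pos (by omega), sub_sub_cancel, map_sub _ (_ - _) (_ • _), map_smul,
      show j + n - 1 = i + j - 1 - (i - n) by ring]
    module
  · rw [if_neg (by omega), if_neg (by omega), S.a_nonpos 2 n (by omega)]
    simp

theorem hasSum_comm_J_a_three (S : IsConstellation β b J a) {i j : ℤ} (hj : 1 ≤ j)
    (f : V) {v w z : V}
    (hv : HasSum (fun p : ℤ × ℤ => ((if p.1 ≤ j - 1 then (i - p.2) *
        ((if 1 ≤ j - p.1 + (i - p.2) then 1 else 0) + if i - p.2 ≤ 0 then 1 else 0) else 0 : ℤ) : K) •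
        J p.1 (J (i + j - 1 - p.2 - p.1) (a 2 p.2 f))) v)
    (hw : HasSum (fun q => (((j - 1) * (i - q) *
        ((if 1 ≤ j + (i - q) then 1 else 0) + if i - q ≤ 0 then 1 else 0)
          - (i - q) * (i - q) * if i - q ≤ 0 then 1 else 0 : ℤ) : K) •
        J (i + j - 1 - q) (a 2 q f)) w)
    (hz : HasSum (fun q => (β * ((i - q : ℤ) : K)) • a 2 (i + j - q) (a 2 q f)) z) :
    HasSum (fun q => J (i - q) (a 3 j (a 2 q f)) - a 3 j (J (i - q) (a 2 q f)))
      (v + z + b • w + (b * b * (j - 1) ^ 2 * (1 - j)) • a 2 (i + j - 1) f) := by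
  have h1 := (hv.prod_fiberwise_right fun q => by
    have h := S.hasSum_J_a_three (i - q) hj (a 2 q f)
    convert h using 2 with x
    rw [show i + j - 1 - q - x = j + (i - q) - 1 - x by ring])
  have h2 : HasSum (fun q => if q = i + j - 1 then
    (b * b * (j - 1) ^ 2 * (1 - j)) • a 2 (i + j - 1) f else 0) _ := hasSum_ite_eq _ _
  convert ((h1.add hz).add (hw.smul_discrete b)).add h2 using 1
  funext q
  have e : (if i - q = 1 - j then (b * b * (j - 1) ^ 2 * (i - q : ℤ)) • a 2 q f else 0) =
      if q = i + j - 1 then (b * b * (j - 1) ^ 2 * (1 - j)) • a 2 (i + j - 1) f else 0 := by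
    by_cases h : q = i + j - 1
    · rw [if_pos (by omega), if_pos h, h]
      push_cast
      module
    · rw [if_neg (by omega), if_neg h]
  rw [e, show j + (i - q) = i + j - q by ring, show i + j - q - 1 = i + j - 1 - q by ring]
  module

theorem hasSum_a_two_a_two_ordered (S : IsConstellation β b J a) (i j : ℤ) (f : V) {v w : V}
    (hv : HasSum (fun p : ℤ × ℤ => ((if 1 ≤ p.2 ∧ p.2 ≤ i + j - 1 ∧ p.1 ≤ i + j - 1 - p.2 then
        (if p.2 < j then i - j else if p.2 ≤ i then i - p.2 else 0) else 0 : ℤ) : K) •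
        J p.1 (J (i + j - 1 - p.2 - p.1) (a 2 p.2 f))) v)
    (hw : HasSum (fun q => ((if 1 ≤ q ∧ q ≤ i + j - 1 then
        (if q < j then i - j else if q ≤ i then i - q else 0) * (i + j - 1 - q) else 0 : ℤ) : K) •
        J (i + j - 1 - q) (a 2 q f)) w) :
    HasSum (fun q => (β * ((if q < j then i - j else if q ≤ i then i - q else 0 : ℤ) : K)) •
      a 2 (i + j - q) (a 2 q f)) (v + b • w) := by
  have h1 := (hv.prod_fiberwise_right (g := fun q =>
      if 1 ≤ q ∧ q ≤ i + j - 1 then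
        ((if q < j then i - j else if q ≤ i then i - q else 0 : ℤ) : K) •
        (β • a 2 (i + j - q) (a 2 q f) - (b * ((i + j - q : ℤ) - 1)) • J (i + j - 1 - q) (a 2 q f))
        else 0) fun q => by
    by_cases hq : 1 ≤ q ∧ q ≤ i + j - 1
    · have h := (S.hasSum_a_two (i + j - q) (by omega) (a 2 q f)).smul_discrete
        ((if q < j then i - j else if q ≤ i then i - q else 0 : ℤ) : K)
      rw [if_pos hq]
      rw [show i + j - q - 1 = i + j - 1 - q by ring] at h
      convert h using 2 with x
      dsimp only
      rw [smul_smul, ← Int.cast_mul]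
      congr 2
      simp only [hq, true_and]
      rw [mul_ite, mul_one, mul_zero]
    · rw [if_neg hq]
      convert hasSum_zero with x
      dsimp only
      rw [if_neg (by tauto)]
      simp)
  convert h1.add (hw.smul_discrete b) using 1
  funext q
  by_cases hq : 1 ≤ q ∧ q ≤ i + j - 1
  · rw [if_pos hq, if_pos hq]
    push_cast [-Int.cast_ite]
    module
  · rw [if_neg hq, if_neg hq]
    by_cases h : 1 ≤ q
    · rw [S.a_nonpos 2 (i + j - q) (by omega)]
      simp
    · rw [S.a_nonpos 2 q (by omega)]
      simp

theorem hasSum_a_two_a_two_remainder [CharZero K] (S : IsConstellation β b J a) {i j : ℤ}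
    (hij : j ≤ i) (f : V) {u : V}
    (hu : HasSum (fun q => (((if q < j then j - q else 0) - (if i < q then q - i else 0) : ℤ) : K) •
      a 2 (i + j - q) (a 2 q f)) u) :
    HasSum (fun x => ((if 0 < x ∧ x < j then x * (i - j + 2 * x) else 0 : ℤ) : K) •
      a 2 (i + j - 1) f) u := by
  obtain ⟨u1, h1⟩ := S.summable_a 2
    (fun q => ((if q < j then j - q else 0 : ℤ) : K) • a 2 (i + j - q)) f
  obtain ⟨u2, h2⟩ := S.summable_a 2
    (fun q => ((if i < q then q - i else 0 : ℤ) : K) • a 2 (i + j - q)) f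
  have h3 : u = u1 - u2 := hu.unique (by
    convert h1.sub h2 using 2 with q
    simp only [LinearMap.smul_apply]
    push_cast [-Int.cast_ite]
    module)
  have h4 := h2.int_reflect (i + j) fun q => rfl
  rw [h3]
  refine (h1.sub h4).int_reflect j fun x => ?_
  simp only [LinearMap.smul_apply]
  rw [sub_sub_cancel, sub_sub_cancel]
  by_cases hx : 0 < x
  · rw [if_pos (by omega : j - x < j), if_pos (by omega : i < i + j - (j - x)),
      show i + j - (j - x) - i = x by ring, ← smul_sub]
    by_cases hxj : x < j
    · have h5 := S.comm_a_two_a_two (by omega : 1 ≤ i + j - (j - x)) (by omega : 1 ≤ j - x) f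
      rw [h5, if_pos ⟨hx, hxj⟩, smul_smul, ← Int.cast_mul]
      congr 2
      · ring_nf
      · ring_nf
    · rw [S.a_nonpos 2 (j - x) (by omega)]
      simp [hxj]
  · rw [if_neg (by omega : ¬ j - x < j), if_neg (by omega : ¬ i < i + j - (j - x)),
      if_neg (by omega)]
    simp

theorem hasSum_coeff_a_succ (S : IsConstellation β b J a) (s : ℕ) (N : ℤ) (d : ℤ → ℤ)
    (f : V) {v w : V}
    (hv : HasSum (fun p : ℤ × ℤ => ((if p.1 ≤ N - 1 then d (N - p.1) else 0 : ℤ) : K) •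
        J p.1 (J (N - p.2 - p.1) (a s p.2 f))) v)
    (hw : HasSum (fun q => ((d q * (q - 1) : ℤ) : K) • J (N - q) (a s q f)) w) :
    HasSum (fun l => (d l : K) • J (N - l) (a (s + 1) l f)) (v + b • w) := by
  have h1 := hv.prod_fiberwise (g := fun x => if x ≤ N - 1 then (d (N - x) : K) •
      J x (a (s + 1) (N - x) f - (b * ((N - x : ℤ) - 1)) • a s (N - x) f) else 0) (fun x => by
    by_cases hx : x ≤ N - 1
    · have h := ((S.a_succ s (N - x) f (by omega)).map_end (J x)).smul_discrete (d (N - x) : K)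
      simp only [hx, if_true]
      convert h using 6 with q
      ring
    · simp [hx])
  have h2 := (hw.smul_discrete b).int_reflect N fun x => rfl
  refine (h1.add h2).int_reflect N fun l => ?_
  by_cases hl : 1 ≤ l
  · rw [if_pos (by omega), sub_sub_cancel, map_sub, map_smul]
    push_cast
    module
  · rw [if_neg (by omega), sub_sub_cancel, S.a_nonpos s l (by omega),
      S.a_nonpos (s + 1) l (by omega)]
    simp

/-- The coefficient of `J x (J (i + j - 1 - q - x) (a 2 q f))` in the cubic commutator minus its
expected value. -/
def defectCoeff (i j x q : ℤ) : ℤ :=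
  (if x ≤ j - 1 then (i - q) *
      ((if 1 ≤ j - x + (i - q) then 1 else 0) + if i - q ≤ 0 then 1 else 0) else 0)
    + (if 1 ≤ q ∧ q ≤ i + j - 1 ∧ x ≤ i + j - 1 - q then
      (if q < j then i - j else if q ≤ i then i - q else 0) else 0)
    - (if x ≤ i - 1 then (if i - x ≤ q then q - (i - x) + 1 - (i - x) else 0) + (j - q) *
      ((if q ≤ j + (i - x) - 1 then 1 else 0) + if j ≤ q then 1 else 0) else 0)
    - (if x ≤ i + j - 1 - 1 then structureCoeff i j (i + j - 1 - x) else 0)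

theorem defectCoeff_antisymm {i j x y q : ℤ} (hj : 1 ≤ j) (hij : j < i) (hq : 1 ≤ q)
    (hx : x ≠ 0) (hy : y ≠ 0) (h : x + y + q = i + j - 1) :
    defectCoeff i j x q + defectCoeff i j y q = 0 := by
  simp only [defectCoeff, structureCoeff_of_lt hij]
  have h1 : x < 0 ∨ 1 ≤ x ∧ x < j ∨ j ≤ x ∧ x < i ∨ i ≤ x ∧ x < i + j - 1 ∨ i + j - 1 ≤ x := by
    omega
  have h2 : y < 0 ∨ 1 ≤ y ∧ y < j ∨ j ≤ y ∧ y < i ∨ i ≤ y ∧ y < i + j - 1 ∨ i + j - 1 ≤ y := by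
    omega
  have h3 : q < j ∨ j ≤ q ∧ q < i ∨ i = q ∨ i < q ∧ q ≤ i + j - 1 ∨ i + j - 1 < q := by omega
  rcases h1 with h1 | ⟨h1, h1'⟩ | ⟨h1, h1'⟩ | ⟨h1, h1'⟩ | h1 <;>
  rcases h2 with h2 | ⟨h2, h2'⟩ | ⟨h2, h2'⟩ | ⟨h2, h2'⟩ | h2 <;>
  rcases h3 with h3 | ⟨h3, h3'⟩ | h3 | ⟨h3, h3'⟩ | h3 <;> first | omega | skip
  all_goals
    simp (disch := omega) only [if_pos, if_neg]
    try omega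

theorem defectCoeff_central {i j x : ℤ} (hj : 1 ≤ j) (hij : j < i) (hx : 0 < x) :
    defectCoeff i j x (i + j - 1) = if x < j then -(i - j + 2 * x) else 0 := by
  simp only [defectCoeff, structureCoeff_of_lt hij]
  have h1 : x < j ∨ j ≤ x ∧ x < i ∨ i ≤ x ∧ x < i + j - 1 ∨ i + j - 1 ≤ x := by
    omega
  have h2 : j = 1 ∨ 1 < j := by omega
  rcases h1 with h1 | ⟨h1, h1'⟩ | ⟨h1, h1'⟩ | h1 <;> rcases h2 with h2 | h2 <;>
    simp (disch := omega) only [if_pos, if_neg] <;> omega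

theorem linear_defect_eq_zero {i j q : ℤ} (hj : 1 ≤ j) (hij : j < i) (hq : 1 ≤ q)
    (hN : q ≠ i + j - 1) :
    -((i - 1) * ((if i ≤ q then q - i + 1 - i else 0) +
        (j - q) * ((if q ≤ i + j - 1 then 1 else 0) + if j ≤ q then 1 else 0)))
      - (if j ≤ q then (j - 1) * (2 * j - q - 1) - (q - j) ^ 2 else 0)
      + ((j - 1) * (i - q) * ((if 1 ≤ j + (i - q) then 1 else 0) + if i - q ≤ 0 then 1 else 0)
          - (i - q) * (i - q) * if i - q ≤ 0 then 1 else 0)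
      + (if 1 ≤ q ∧ q ≤ i + j - 1 then
          (if q < j then i - j else if q ≤ i then i - q else 0) * (i + j - 1 - q) else 0)
      - structureCoeff i j q * (q - 1) - (i - j) * (i + j - 2) = 0 := by
  rw [structureCoeff_of_lt hij]
  have h3 : q < j ∨ j ≤ q ∧ q < i ∨ i = q ∨ i < q ∧ q ≤ i + j - 1 ∨ i + j - 1 < q := by omega
  rcases h3 with h3 | ⟨h3, h3'⟩ | h3 | ⟨h3, h3'⟩ | h3 <;>
    simp (disch := omega) only [if_pos, if_neg]
  all_goals first | ring1 | (subst h3; ring1)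

theorem hasSum_comm_a_three_of_lt [CharZero K] (S : IsConstellation β b J a) {i j : ℤ}
    (hj : 1 ≤ j) (hij : j < i) (f : V) :
    HasSum (fun l => (structureCoeff i j l : K) • J (i + j - 1 - l) (a 3 l f))
      (a 3 i (a 3 j f) - a 3 j (a 3 i f)
        - (b * ((i - j) * (i + j - 2) : ℤ)) • a 3 (i + j - 1) f) := by
  obtain ⟨v1, h1⟩ := S.hasSum_double_coeff 2 (i + j - 1) (i - 1) (fun x q =>
    if x ≤ i - 1 then (if i - x ≤ q then q - (i - x) + 1 - (i - x) else 0) + (j - q) *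
          ((if q ≤ j + (i - x) - 1 then 1 else 0) + if j ≤ q then 1 else 0) else 0)
    (fun x q h => if_neg (by omega)) f
  obtain ⟨w1, k1⟩ := S.hasSum_single_coeff 2 (i + j - 1)
    (fun q => if j ≤ q then (j - 1) * (2 * j - q - 1) - (q - j) ^ 2 else 0) f
  obtain ⟨v2, h2⟩ := S.hasSum_double_coeff 2 (i + j - 1) (j - 1) (fun x q =>
    if x ≤ j - 1 then (i - q) *
        ((if 1 ≤ j - x + (i - q) then 1 else 0) + if i - q ≤ 0 then 1 else 0) else 0)
    (fun x q h => if_neg (by omega)) f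
  obtain ⟨w2, k2⟩ := S.hasSum_single_coeff 2 (i + j - 1) (fun q => (j - 1) * (i - q) *
        ((if 1 ≤ j + (i - q) then 1 else 0) + if i - q ≤ 0 then 1 else 0)
          - (i - q) * (i - q) * if i - q ≤ 0 then 1 else 0) f
  obtain ⟨v3, h3⟩ := S.hasSum_double_coeff 2 (i + j - 1) (i + j - 1) (fun x q =>
    if 1 ≤ q ∧ q ≤ i + j - 1 ∧ x ≤ i + j - 1 - q then
        (if q < j then i - j else if q ≤ i then i - q else 0) else 0)
    (fun x q h => if_neg (by omega)) f
  obtain ⟨w3, k3⟩ := S.hasSum_single_coeff 2 (i + j - 1) (fun q => if 1 ≤ q ∧ q ≤ i + j - 1 then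
        (if q < j then i - j else if q ≤ i then i - q else 0) * (i + j - 1 - q) else 0) f
  obtain ⟨v4, h4⟩ := S.hasSum_double_coeff 2 (i + j - 1) (i + j - 2) (fun x q =>
    if x ≤ i + j - 1 - 1 then structureCoeff i j (i + j - 1 - x) else 0)
    (fun x q h => if_neg (by omega)) f
  obtain ⟨w4, k4⟩ := S.hasSum_single_coeff 2 (i + j - 1)
    (fun q => structureCoeff i j q * (q - 1)) f
  obtain ⟨u, hu⟩ := S.summable_a 2 (fun q => (((if q < j then j - q else 0) -
    (if i < q then q - i else 0) : ℤ) : K) • a 2 (i + j - q)) f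
  have hz : HasSum (fun q => (β * ((i - q : ℤ) : K)) • a 2 (i + j - q) (a 2 q f))
      (v3 + b • w3 + β • u) := by
    convert (S.hasSum_a_two_a_two_ordered i j f h3 k3).add (hu.smul_discrete β) using 2 with q
    rw [LinearMap.smul_apply, smul_smul, ← add_smul, ← mul_add, ← Int.cast_add]
    by_cases hq : 1 ≤ q
    · congr 3
      split_ifs <;> omega
    · simp [S.a_nonpos 2 q (by omega)]
  have hW := (S.hasSum_comm_succ (a 3 j) 2 (by omega : 1 ≤ i) f).unique (by
    convert (S.hasSum_J_comm_a_three_a_two hj f h1 k1).sub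
      (S.hasSum_comm_J_a_three hj f h2 k2 hz) using 2 with q
    rw [map_sub]
    abel)
  have hX := S.hasSum_comm_a_two 2 hj (by omega : 1 ≤ i) f (fun m => m - i)
        fun m hm => S.comm_a_two_a_two hm (by omega) f
  have hY := S.a_succ 2 (i + j - 1) f (by omega)
  have hT := S.hasSum_coeff_a_succ 2 (i + j - 1) (structureCoeff i j) f h4 k4
  have hC := S.hasSum_central_of_antisymm 2 (i + j - 1) (i + j - 1) (defectCoeff i j)
    (fun x q h => by
      rw [defectCoeff, if_neg (by omega), if_neg (by omega), if_neg (by omega), if_neg (by omega)]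
      rfl)
    (fun x q hq hx hy => defectCoeff_antisymm hj hij hq hx hy (by ring)) (by omega) f
    (v := v2 + v3 - v1 - v4) (by
      convert ((h2.add h3).sub h1).sub h4 using 2 with p
      rw [defectCoeff]
      push_cast [-Int.cast_ite]
      module)
  have hCu : v2 + v3 - v1 - v4 = -(β • u) := by
    refine hC.unique ?_
    convert ((S.hasSum_a_two_a_two_remainder hij.le f hu).smul_discrete β).neg using 2 with x
    by_cases hx : 0 < x
    · rw [if_pos hx, defectCoeff_central hj hij hx]
      by_cases hxj : x < j
      · rw [if_pos hxj, if_pos ⟨hx, hxj⟩]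
        push_cast
        module
      · simp [hxj]
    · simp [hx]
  rw [add_comm j i] at hX
  have hL := ((((((hX.smul_discrete ((i - 1 : ℤ) : K)).neg.sub k1).add k2).add k3).sub k4).sub
    (hY.smul_discrete (((i - j) * (i + j - 2) : ℤ) : K))).unique (a₂ := 0) (by
      convert hasSum_zero with q
      simp only [smul_smul, ← Int.cast_mul, ← sub_smul, ← add_smul, ← neg_smul,
        ← Int.cast_neg, ← Int.cast_add, ← Int.cast_sub]
      by_cases hq : 1 ≤ q
      · by_cases hqN : q = i + j - 1
        · rw [hqN, sub_self, S.J_zero]; simp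
        · rw [linear_defect_eq_zero hj hij hq hqN]; simp
      · rw [S.a_nonpos 2 q (by omega)]
        simp)
  have h0 : (b * b * (-((i - 1) * ((j - 1) * (j - i) - (i - 1) ^ 2)) - (j - 1) ^ 3
      - (i - j) * (i + j - 2) ^ 2) : K) • a 2 (i + j - 1) f = 0 := by
    rw [show (b * b * (-((i - 1) * ((j - 1) * (j - i) - (i - 1) ^ 2)) - (j - 1) ^ 3
      - (i - j) * (i + j - 2) ^ 2) : K) = 0 by ring, zero_smul]
  convert hT using 1
  push_cast at hW hL ⊢
  linear_combination (norm := module) hCu + b • hL - hW + h0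

/-- The structure operators of the cubic model, indexed by integers. -/
def structureOp (b : K) (J : ℤ → Module.End K V) (i j l : ℤ) : ℕ → Module.End K V
  | 2 => if l = i + j - 1 then ((i - j : ℤ) : K) • 1 else 0
  | 3 => (structureCoeff i j l : K) • J (i + j - 1 - l) +
      (b * ((i - j) * (i + j - 2) : ℤ)) • if l = i + j - 1 then 1 else 0
  | _ => 0

theorem structureOp_symm (i j l : ℤ) (s : ℕ) :
    structureOp b J j i l s = -structureOp b J i j l s := by
  match s with
  | 0 | 1 | _ + 4 => exact neg_zero.symm
  | 2 =>
    simp only [structureOp]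
    rw [add_comm j i]
    split_ifs
    · push_cast
      module
    · simp
  | 3 =>
    simp only [structureOp]
    rw [add_comm j i, structureCoeff_symm i j]
    push_cast [-Int.cast_ite]
    module

theorem hasSum_structureOp_two (i j : ℤ) (g : ℤ → V) :
    HasSum (fun l => structureOp b J i j l 2 (g l)) (((i - j : ℤ) : K) • g (i + j - 1)) := by
  convert hasSum_ite_eq (i + j - 1) (((i - j : ℤ) : K) • g (i + j - 1)) using 2 with l
  simp only [structureOp]
  split_ifs with h
  · simp [h]
  · simp

theorem hasSum_structureOp_three {i j : ℤ} {g : ℤ → V} {v : V}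
    (h : HasSum (fun l => (structureCoeff i j l : K) • J (i + j - 1 - l) (g l)) v) :
    HasSum (fun l => structureOp b J i j l 3 (g l))
      (v + (b * ((i - j) * (i + j - 2) : ℤ)) • g (i + j - 1)) := by
  convert h.add (hasSum_ite_eq (i + j - 1) ((b * ((i - j) * (i + j - 2) : ℤ)) • g (i + j - 1)))
    using 2 with l
  simp only [structureOp]
  split_ifs with h
  · simp [h]
  · simp

theorem hasSum_of_antisymm_of_lt [CharZero K] {F : ℤ → ℤ → ℤ → V} {G : ℤ → ℤ → V}
    (hF : ∀ i j l, F j i l = -F i j l) (hG : ∀ i j, G j i = -G i j)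
    (h : ∀ i j, 1 ≤ j → j < i → HasSum (F i j) (G i j)) {i j : ℤ} (hi : 1 ≤ i) (hj : 1 ≤ j) :
    HasSum (F i j) (G i j) := by
  have h0 : ∀ v : V, v = -v → v = 0 := fun v hv => by
    have h2 : (2 : K) • v = 0 := by
      rw [two_smul]
      nth_rewrite 1 [hv]
      exact neg_add_cancel v
    exact (smul_eq_zero.1 h2).resolve_left two_ne_zero
  rcases lt_trichotomy i j with h1 | rfl | h1
  · rw [hG j i, funext (hF j i)]
    exact (h j i hi h1).neg
  · rw [h0 _ (hG i i), funext fun l => h0 _ (hF i i l)]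
    exact hasSum_zero
  · exact h i j hj h1

theorem a_zero_commute (S : IsConstellation β b J a) (i : ℤ) (T : Module.End K V) (f : V) :
    a 0 i (T f) = T (a 0 i f) := by
  by_cases h : i = 1
  · have h1 : ∀ g, a 0 1 g = β⁻¹ • g := fun g => by
      nth_rewrite 2 [← S.a_zero_one g]
      rw [smul_smul, inv_mul_cancel₀ S.charge_ne_zero, one_smul]
    rw [h, h1, h1, map_smul]
  · simp [S.a_zero i h]

theorem structureOp_a_zero (S : IsConstellation β b J a) {i j : ℤ} (hj : 1 ≤ j) (hij : j < i)
    (l : ℤ) (s : ℕ) (f : V) : structureOp b J i j l s (a 0 l f) = 0 := by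
  by_cases h : l = 1
  · subst h
    match s with
    | 0 | 1 | _ + 4 => rfl
    | 2 =>
      simp only [structureOp]
      rw [if_neg (by omega)]
      rfl
    | 3 =>
      have : structureCoeff i j 1 = 0 := by
        rw [structureCoeff_of_lt hij]
        split_ifs <;> omega
      simp only [structureOp]
      rw [if_neg (by omega), this]
      simp
  · simp [S.a_zero l h]

theorem hasSum_comm_a_one_a_three [CharZero K] (S : IsConstellation β b J a) {i j : ℤ}
    (hj : 1 ≤ j) (hij : j < i) (f : V) :
    HasSum (fun l => structureOp b J i j l 3 (a 1 l f))
      (a 1 i (a 3 j f) - a 3 j (a 1 i f) - (a 1 j (a 3 i f) - a 3 i (a 1 j f))) := by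
  obtain ⟨t, ht⟩ := S.hasSum_single_coeff 1 (i + j - 1) (structureCoeff i j) f
  have h1 := S.hasSum_J_a_three (i - 1) hj f
  have h2 := S.hasSum_J_a_three (j - 1) (by omega : 1 ≤ i) f
  rw [show j + (i - 1) = i + j - 1 by ring] at h1
  rw [show i + (j - 1) = i + j - 1 by ring] at h2
  have h3 := S.hasSum_a_two (i + j - 1) (by omega) f
  have h4 : HasSum (fun x => ((if x ≤ i + j - 1 - 1 then structureCoeff i j (i + j - 1 - x) else 0
      : ℤ) : K) • J x (J (i + j - 1 - 1 - x) f)) (β • t) := by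
    refine (ht.smul_discrete β).int_reflect (i + j - 1) fun x => ?_
    by_cases hx : x ≤ i + j - 1 - 1
    · rw [if_pos hx, sub_sub_cancel, S.a_one (by omega), map_smul, smul_comm β, smul_smul β,
        mul_inv_cancel₀ S.charge_ne_zero, one_smul, sub_right_comm (i + j - 1)]
    · rw [if_neg hx, S.a_nonpos 1 (i + j - 1 - x) (by omega)]
      simp
  have h5 := eq_zero_of_hasSum_antisymm (K := K)
    (((h1.sub h2).add (h3.smul_discrete ((i - j : ℤ) : K))).sub h4) (i + j - 1 - 1) fun x => by
      rw [sub_sub_cancel, S.J_comm (i + j - 1 - 1 - x) x,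
        if_neg (by omega : ¬ i + j - 1 - 1 - x + x = 0), add_zero]
      simp only [smul_smul, ← Int.cast_mul, ← sub_smul, ← add_smul, ← neg_smul,
        ← Int.cast_neg, ← Int.cast_add, ← Int.cast_sub]
      by_cases hx : x = 0
      · rw [hx, S.J_zero]; simp
      by_cases hy : i + j - 1 - 1 - x = 0
      · rw [hy, S.J_zero]; simp
      congr 2
      simp only [structureCoeff_of_lt hij]
      have h1 : x < 0 ∨ 1 ≤ x ∧ x < j ∨ j ≤ x ∧ x < i ∨ i ≤ x ∧ x < i + j - 1 ∨ i + j - 1 ≤ x := by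
        omega
      have h2 : i + j - 1 - 1 - x < j ∨ j ≤ i + j - 1 - 1 - x := by omega
      have h3 : j = 1 ∨ 1 < j := by omega
      rcases h1 with h1 | ⟨h1, h1'⟩ | ⟨h1, h1'⟩ | ⟨h1, h1'⟩ | h1 <;> rcases h3 with h3 | h3 <;>
        rcases h2 with h2 | h2 <;>
        simp (disch := omega) only [if_pos, if_neg] <;> omega
  convert hasSum_structureOp_three ht using 1
  rw [S.a_one (by omega), S.a_one (by omega), S.a_one hj, S.a_one hj, S.a_one (by omega)]
  have h6 : (j - 1) * (i - 1) * ((if 1 ≤ i + j - 1 then 1 else 0) + if i - 1 ≤ 0 then 1 else 0) -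
      (i - 1) * (i - 1) * (if i - 1 ≤ 0 then 1 else 0) = (i - 1) * (j - 1) := by
    rw [if_pos (by omega), if_neg (by omega)]
    ring
  have h7 : (i - 1) * (j - 1) * ((if 1 ≤ i + j - 1 then 1 else 0) + if j - 1 ≤ 0 then 1 else 0) -
      (j - 1) * (j - 1) * (if j - 1 ≤ 0 then 1 else 0) = (i - 1) * (j - 1) := by
    rw [if_pos (by omega)]
    rcases (by omega : j = 1 ∨ 1 < j) with rfl | h
    · ring
    · rw [if_neg (by omega)]
      ring
  rw [h6, h7, if_neg (by omega), if_neg (by omega)] at h5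
  have h8 := inv_smul_smul₀ S.charge_ne_zero t
  push_cast at h5 ⊢
  simp only [map_smul]
  linear_combination (norm := module) β⁻¹ • h5 + h8

theorem hasSum_comm_a_two_a_three [CharZero K] (S : IsConstellation β b J a) {i j : ℤ}
    (hj : 1 ≤ j) (hij : j < i) (f : V) :
    HasSum (fun l => structureOp b J i j l 3 (a 2 l f) + structureOp b J i j l 2 (a 3 l f))
      (a 2 i (a 3 j f) - a 3 j (a 2 i f) - (a 2 j (a 3 i f) - a 3 i (a 2 j f))) := by
  have h1 := S.hasSum_comm_a_two 2 (by omega : 1 ≤ i) hj f (fun m => m - j)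
    fun m hm => S.comm_a_two_a_two hm hj f
  have h2 := S.hasSum_comm_a_two 2 hj (by omega : 1 ≤ i) f (fun m => m - i)
    fun m hm => S.comm_a_two_a_two hm (by omega) f
  have h3 := S.a_succ 2 (i + j - 1) f (by omega)
  rw [add_comm j i] at h2
  have h4 : HasSum (fun l => (structureCoeff i j l : K) • J (i + j - 1 - l) (a 2 l f))
      (a 3 i (a 2 j f) - a 2 j (a 3 i f) - (a 3 j (a 2 i f) - a 2 i (a 3 j f))
        - (b * ((i - j) * (i + j - 2) : ℤ)) • a 2 (i + j - 1) f
        - ((i - j : ℤ) : K) • a 3 (i + j - 1) f) := by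
    convert (h1.sub h2).sub (h3.smul_discrete ((i - j : ℤ) : K)) using 1
    · funext q
      simp only [← sub_smul, ← Int.cast_sub]
      by_cases hq : 1 ≤ q
      swap
      · rw [S.a_nonpos 2 q (by omega)]
        simp
      by_cases hqN : q = i + j - 1
      · rw [hqN, sub_self, S.J_zero]; simp
      · congr 2
        rw [structureCoeff_of_lt hij]
        have h3 : q < j ∨ j ≤ q ∧ q < i ∨ i ≤ q ∧ q ≤ i + j - 1 ∨ i + j - 1 < q := by omega
        rcases h3 with h3 | ⟨h3, h3'⟩ | ⟨h3, h3'⟩ | h3 <;>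
          simp (disch := omega) only [if_pos, if_neg] <;> ring
    · push_cast
      module
  convert (hasSum_structureOp_three h4).add (hasSum_structureOp_two i j fun l => a 3 l f) using 1
  push_cast
  module

theorem summable_J (S : IsConstellation β b J a) (T : ℤ → Module.End K V) (f : V) :
    Summable fun l => if 1 ≤ l then T l (J l f) else 0 := by
  obtain ⟨N, hN⟩ := Filter.eventually_atTop.1 (S.J_eventually f)
  refine (hasSum_sum_of_ne_finset_zero (s := Finset.Ico 1 N) fun q hq => ?_).summable
  rw [Finset.mem_Ico] at hq
  by_cases h1 : 1 ≤ q
  · rw [hN q (by omega)]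
    simp
  · simp [h1]

theorem hasSum_comm_J_a_three_antisymm [CharZero K] (S : IsConstellation β b J a) {i j : ℤ}
    (hj : 1 ≤ j) (hij : j < i) (f : V) :
    HasSum (fun l => structureOp b J i j l 3 (if 1 ≤ l then J l f else 0))
      (J i (a 3 j f) - a 3 j (J i f) - (J j (a 3 i f) - a 3 i (J j f))) := by
  obtain ⟨t, ht⟩ := S.summable_J (fun l => (structureCoeff i j l : K) • J (i + j - 1 - l)) f
  have h1 := S.hasSum_J_a_three i hj f
  have h2 := S.hasSum_J_a_three j (by omega : 1 ≤ i) f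
  rw [add_comm j i] at h1
  have h3 := S.hasSum_a_two (i + j) (by omega) f
  have h4 := ht.int_reflect (i + j - 1) fun x => rfl
  have h5 := eq_zero_of_hasSum_antisymm (K := K)
    (((h1.sub h2).add (h3.smul_discrete ((i - j : ℤ) : K))).sub h4) (i + j - 1) fun x => by
      have h0 : (if 1 ≤ i + j - 1 - (i + j - 1 - x) then
          ((structureCoeff i j (i + j - 1 - (i + j - 1 - x)) : K) •
            J (i + j - 1 - (i + j - 1 - (i + j - 1 - x)))) (J (i + j - 1 - (i + j - 1 - x)) f)
          else 0) = ((if 1 ≤ x then structureCoeff i j x else 0 : ℤ) : K) •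
            J x (J (i + j - 1 - x) f) := by
        rw [sub_sub_cancel, LinearMap.smul_apply, S.J_comm (i + j - 1 - x) x,
          if_neg (by omega : ¬ i + j - 1 - x + x = 0), add_zero]
        split_ifs <;> simp
      have h0' : (if 1 ≤ i + j - 1 - x then
          ((structureCoeff i j (i + j - 1 - x) : K) •
            J (i + j - 1 - (i + j - 1 - x))) (J (i + j - 1 - x) f)
          else 0) = ((if 1 ≤ i + j - 1 - x then structureCoeff i j (i + j - 1 - x) else 0 : ℤ) : K) •
            J x (J (i + j - 1 - x) f) := by
        rw [sub_sub_cancel, LinearMap.smul_apply]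
        split_ifs <;> simp
      rw [h0, h0']
      rw [sub_sub_cancel, S.J_comm (i + j - 1 - x) x, if_neg (by omega : ¬ i + j - 1 - x + x = 0),
        add_zero]
      simp only [smul_smul, ← Int.cast_mul, ← sub_smul, ← add_smul, ← neg_smul,
        ← Int.cast_neg, ← Int.cast_add, ← Int.cast_sub]
      by_cases hx : x = 0
      · rw [hx, S.J_zero]; simp
      by_cases hy : i + j - 1 - x = 0
      · rw [hy, S.J_zero]; simp
      congr 2
      simp only [structureCoeff_of_lt hij]
      have h1 : x < 0 ∨ 1 ≤ x ∧ x < j ∨ j ≤ x ∧ x < i ∨ i ≤ x ∧ x < i + j - 1 ∨ i + j - 1 < x := by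
        omega
      have h2 : i + j - 1 - x < j ∨ j ≤ i + j - 1 - x := by omega
      rcases h1 with h1 | ⟨h1, h1'⟩ | ⟨h1, h1'⟩ | ⟨h1, h1'⟩ | h1 <;>
        rcases h2 with h2 | h2 <;>
        simp (disch := omega) only [if_pos, if_neg] <;> omega
  have h6 : HasSum (fun l => (structureCoeff i j l : K) •
      J (i + j - 1 - l) (if 1 ≤ l then J l f else 0)) t := by
    convert ht using 2 with l
    split_ifs <;> simp
  convert hasSum_structureOp_three h6 using 1
  simp only [if_pos (by omega : 1 ≤ i + j), if_neg (by omega : ¬ i ≤ 0), if_neg (by omega : ¬ j ≤ 0),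
    if_neg (by omega : ¬ i = 1 - j), if_neg (by omega : ¬ j = 1 - i)] at h5
  rw [if_pos (by omega)]
  push_cast at h5 ⊢
  linear_combination (norm := module) h5

/-- The commutation relations of the operators `a s i` up to level three. -/
theorem hasSum_comm_a_a [CharZero K] (S : IsConstellation β b J a) {i j : ℤ} (hi : 1 ≤ i)
    (hj : 1 ≤ j) {s s' : ℕ} (hs : s ≤ 3) (hs' : s' ≤ 3) (f : V) :
    HasSum (fun l => structureOp b J i j l s' (a s l f) + structureOp b J i j l s (a s' l f))
      (a s i (a s' j f) - a s' j (a s i f) - (a s j (a s' i f) - a s' i (a s j f))) := by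
  refine hasSum_of_antisymm_of_lt (K := K)
    (F := fun i j l => structureOp b J i j l s' (a s l f) + structureOp b J i j l s (a s' l f))
    (G := fun i j => a s i (a s' j f) - a s' j (a s i f) - (a s j (a s' i f) - a s' i (a s j f)))
    (fun i j l => by rw [structureOp_symm i j, structureOp_symm i j]; simp [add_comm])
    (fun i j => by abel) (fun i j hj hij => ?_) hi hj
  wlog hss : s ≤ s' generalizing s s'
  · convert this hs' hs (by omega) using 1
    · funext l
      exact add_comm _ _
    · abel
  have h00 : ∀ s l (g : V), s ≤ 1 → structureOp b J i j l s g = 0 := fun s l g h => by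
    interval_cases s <;> rfl
  rcases (by omega : s = 0 ∨ 1 ≤ s) with rfl | hs1
  · simp only [S.structureOp_a_zero hj hij, h00 0, zero_le, S.a_zero_commute, sub_self, add_zero]
    exact hasSum_zero
  have hi : 1 ≤ i := by omega
  interval_cases s <;> interval_cases s'
  · simp only [h00 1 _ _ le_rfl]
    convert hasSum_zero using 1
    · simp
    · simp only [S.a_one hi, S.a_one hj, map_smul, S.J_comm (i - 1) (j - 1),
        if_neg (by omega : ¬ i - 1 + (j - 1) = 0)]
      module
  · simp only [h00 1 _ _ le_rfl, add_zero]
    convert hasSum_structureOp_two i j fun l => a 1 l f using 1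
    have h1 := S.comm_a_one_a_two hi hj f
    have h2 := S.comm_a_one_a_two hj hi f
    rw [add_comm j i] at h2
    push_cast at h1 h2 ⊢
    linear_combination (norm := module) h1 - h2
  · simp only [h00 1 _ _ le_rfl, add_zero]
    exact S.hasSum_comm_a_one_a_three hj hij f
  · convert (hasSum_structureOp_two i j fun l => a 2 l f).add
      (hasSum_structureOp_two i j fun l => a 2 l f) using 1
    have h1 := S.comm_a_two_a_two hi hj f
    linear_combination (norm := module) (2 : K) • h1
  · exact S.hasSum_comm_a_two_a_three hj hij f
  · have h := hasSum_structureOp_three (b := b) (S.hasSum_comm_a_three_of_lt hj hij f)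
    convert h.add h using 1
    module

/-- The commutation relations of the Heisenberg generators with the operators `a s i`. -/
theorem hasSum_comm_J_a [CharZero K] (S : IsConstellation β b J a) {i j : ℤ} (hi : 1 ≤ i)
    (hj : 1 ≤ j) {s : ℕ} (hs : s ≤ 3) (f : V) :
    HasSum (fun l => structureOp b J i j l s (if 1 ≤ l then J l f else 0))
      (J i (a s j f) - a s j (J i f) - (J j (a s i f) - a s i (J j f))) := by
  refine hasSum_of_antisymm_of_lt (K := K)
    (F := fun i j l => structureOp b J i j l s (if 1 ≤ l then J l f else 0))
    (G := fun i j => J i (a s j f) - a s j (J i f) - (J j (a s i f) - a s i (J j f)))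
    (fun i j l => by rw [structureOp_symm i j]; rfl)
    (fun i j => by abel) (fun i j hj hij => ?_) hi hj
  have hi : 1 ≤ i := by omega
  interval_cases s
  · simp only [S.a_zero_commute, sub_self]
    exact hasSum_zero
  · rw [S.J_a_one i hj, S.J_a_one j hi, if_neg (by omega), if_neg (by omega)]
    simp only [add_zero, sub_self]
    exact hasSum_zero
  · convert hasSum_structureOp_two i j fun l => if 1 ≤ l then J l f else 0 using 1
    rw [S.J_a_two i hj, S.J_a_two j hi, add_comm j i]
    simp only [if_pos (by omega : 1 ≤ i + j), if_neg (by omega : ¬ i ≤ 0),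
      if_neg (by omega : ¬ j ≤ 0), if_neg (by omega : ¬ i = 1 - j),
      if_neg (by omega : ¬ j = 1 - i), if_pos (by omega : 1 ≤ i + j - 1)]
    push_cast
    module
  · exact S.hasSum_comm_J_a_three_antisymm hj hij f

end IsConstellation

end Constellation

theorem Int.eq_zero_or_eq_pnat_or_eq_neg_pnat (m : ℤ) :
    m = 0 ∨ ∃ x : ℕ+, m = (x : ℕ) ∨ m = -(x : ℕ) := by
  rcases eq_or_ne m 0 with h | h
  · exact Or.inl h
  · refine Or.inr ⟨m.natAbs.toPNat (Int.natAbs_pos.2 h), ?_⟩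
    rw [Nat.toPNat, PNat.mk_coe]
    omega

theorem Jop_zero (K : Type) [Field K] (b : K) : Jop K b 0 = 0 := by
  simp [Jop, mulpN]

theorem Jop_pos {K : Type} [Field K] (b : K) (x : ℕ+) (f : Rp K) :
    Jop K b (x : ℕ) f = ((1 + b) * (x : ℕ)) • MvPolynomial.pderiv x f := by
  have h : pderivN K (x : ℕ) = (MvPolynomial.pderiv x).toLinearMap := dif_pos x.pos
  rw [Jop, if_pos (by exact_mod_cast x.pos), Int.toNat_natCast, h, Int.cast_natCast]
  rfl

theorem Jop_neg {K : Type} [Field K] (b : K) (x : ℕ+) (f : Rp K) :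
    Jop K b (-(x : ℕ)) f = MvPolynomial.X x * f := by
  have h : mulpN K (x : ℕ) = LinearMap.mulLeft K (MvPolynomial.X x) := dif_pos x.pos
  rw [Jop, if_neg (by omega), neg_neg, Int.toNat_natCast, h]
  rfl

theorem pderiv_pderiv_comm {R σ : Type*} [CommRing R] (x y : σ) (f : MvPolynomial σ R) :
    MvPolynomial.pderiv x (MvPolynomial.pderiv y f) =
      MvPolynomial.pderiv y (MvPolynomial.pderiv x f) := by
  classical
  have h : ⁅MvPolynomial.pderiv (R := R) x, MvPolynomial.pderiv (R := R) y⁆ = 0 := by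
    refine MvPolynomial.derivation_ext fun i => ?_
    simp [Derivation.commutator_apply, MvPolynomial.pderiv_X, Pi.single_apply, apply_ite]
  rw [← sub_eq_zero, ← Derivation.commutator_apply, h, Derivation.zero_apply]

theorem Jop_pos_Jop_neg {K : Type} [Field K] (b : K) (x y : ℕ+) (f : Rp K) :
    Jop K b (x : ℕ) (Jop K b (-(y : ℕ)) f) = Jop K b (-(y : ℕ)) (Jop K b (x : ℕ) f) +
      if x = y then ((1 + b) * (x : ℕ)) • f else 0 := by
  classical
  rw [Jop_pos, Jop_neg, Jop_pos, Jop_neg, Derivation.leibniz, MvPolynomial.pderiv_X]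
  by_cases h : x = y
  · subst h
    simp [MvPolynomial.smul_eq_C_mul]
    ring
  · simp [h]

theorem Jop_comm {K : Type} [Field K] (b : K) (m n : ℤ) (f : Rp K) : Jop K b m (Jop K b n f) =
    Jop K b n (Jop K b m f) + if m + n = 0 then ((1 + b) * m) • f else 0 := by
  rcases m.eq_zero_or_eq_pnat_or_eq_neg_pnat with rfl | ⟨x, rfl | rfl⟩
  · simp [Jop_zero]
  · rcases n.eq_zero_or_eq_pnat_or_eq_neg_pnat with rfl | ⟨y, rfl | rfl⟩
    · simp [Jop_zero]
    · rw [if_neg (by have := x.pos; omega), Jop_pos, Jop_pos, Jop_pos, Jop_pos,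
        Derivation.map_smul, Derivation.map_smul, pderiv_pderiv_comm, smul_comm, add_zero]
    · simp [Jop_pos_Jop_neg, ← sub_eq_add_neg, sub_eq_zero]
  · rcases n.eq_zero_or_eq_pnat_or_eq_neg_pnat with rfl | ⟨y, rfl | rfl⟩
    · simp [Jop_zero]
    · rw [Jop_pos_Jop_neg]
      by_cases h : x = y
      · subst h
        simp
      · have : (x : ℕ) ≠ y := fun h' => h (PNat.eq h')
        rw [if_neg (Ne.symm h), if_neg (by omega), add_zero, add_zero]
    · rw [if_neg (by have := x.pos; omega), Jop_neg, Jop_neg, Jop_neg, Jop_neg,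
        mul_left_comm, add_zero]

theorem Jop_eventually {K : Type} [Field K] (b : K) (f : Rp K) :
    ∀ᶠ k in Filter.atTop, Jop K b k f = 0 := by
  filter_upwards [Filter.eventually_gt_atTop ((f.vars.sup fun x : ℕ+ => (x : ℕ) : ℕ) : ℤ)]
    with k hk
  rcases k.eq_zero_or_eq_pnat_or_eq_neg_pnat with rfl | ⟨x, rfl | rfl⟩
  · simp [Jop_zero]
  · rw [Jop_pos, MvPolynomial.pderiv_eq_zero_of_notMem_vars, smul_zero]
    intro h
    have := Finset.le_sup (f := fun x : ℕ+ => (x : ℕ)) h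
    omega
  · omega

/-- A locally finite sum over the positive integers, as a sum over the integers. -/
theorem hasSum_int_iff_finsum {V : Type*} [AddCommGroup V] [TopologicalSpace V]
    [DiscreteTopology V] {F : ℕ → V} {g : ℤ → V} {v : V} (hg : ∀ n, n ≤ 0 → g n = 0)
    (h : ∀ n : ℕ, 1 ≤ n → g n = F n) :
    HasSum g v ↔ v = ∑ᶠ n ∈ Set.Ici (1 : ℕ), F n ∧
      (Set.Ici 1 ∩ Function.support F).Finite := by
  have h0 : (fun n : ℕ => g n) = fun n => ∑ᶠ _ : n ∈ Set.Ici 1, F n := by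
    funext n
    by_cases hn : 1 ≤ n
    · rw [finsum_eq_if, if_pos (Set.mem_Ici.2 hn), h n hn]
    · rw [finsum_eq_if, if_neg (by simpa using hn), hg n (by omega)]
  have h1 : Function.support (fun n : ℕ => g n) = Set.Ici 1 ∩ Function.support F := by
    ext n
    by_cases hn : 1 ≤ n
    · simp [h n hn, hn]
    · simp [hg n (by omega), hn]
  have h2 : HasSum g v ↔ HasSum (fun n : ℕ => g n) v := by
    refine (Nat.cast_injective.hasSum_iff (f := g) fun x hx => hg x ?_).symm
    by_contra hx0
    exact hx ⟨x.toNat, by omega⟩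
  rw [h2, ← h1, ← h0]
  constructor
  · intro hs
    have hfin := hs.summable.hasFiniteSupport_of_discreteTopology
    exact ⟨by rw [← tsum_eq_finsum (L := SummationFilter.unconditional ℕ) hfin, hs.tsum_eq], hfin⟩
  · rintro ⟨rfl, hfin⟩
    rw [← tsum_eq_finsum (L := SummationFilter.unconditional ℕ) hfin]
    exact (summable_of_hasFiniteSupport hfin).hasSum

theorem Dcoef_eq_structureOp {K : Type} [Field K] (b : K) (i j l s : ℕ) :
    Dcoef K b i j l s = IsConstellation.structureOp b (Jop K b) i j l s := by
  match s with
  | 0 | 1 | _ + 4 => rfl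
  | 2 => simp only [Dcoef, IsConstellation.structureOp, Int.cast_sub, Int.cast_natCast]
  | 3 =>
    rw [Dcoef, IsConstellation.structureOp, IsConstellation.structureCoeff]
    simp only [← Nat.cast_max, ← Nat.cast_min, Nat.cast_le, Nat.cast_lt]
    push_cast
    simp only [mul_assoc]

/-- The operators `A_i(s)`, extended by zero to nonpositive indices. -/
def extendByZero {V : Type*} [AddCommMonoid V] (A : ℕ → ℕ → V) (s : ℕ) (i : ℤ) : V :=
  if 1 ≤ i then A i.toNat s else 0

theorem extendByZero_natCast {V : Type*} [AddCommMonoid V] (A : ℕ → ℕ → V) (s : ℕ) {i : ℕ}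
    (hi : 1 ≤ i) : extendByZero A s i = A i s := by
  rw [extendByZero, if_pos (by exact_mod_cast hi), Int.toNat_natCast]

theorem extendByZero_nonpos {V : Type*} [AddCommMonoid V] (A : ℕ → ℕ → V) (s : ℕ) {i : ℤ}
    (hi : i ≤ 0) : extendByZero A s i = 0 :=
  if_neg (by omega)

theorem isConstellation_Jop {K : Type} [Field K] [TopologicalSpace (Rp K)]
    [DiscreteTopology (Rp K)] (b : K) (hb : (1 : K) + b ≠ 0)
    (A : ℕ → ℕ → Module.End K (Rp K))
    (hbase1 : A 1 0 = ((1 : K) + b)⁻¹ • (1 : Module.End K (Rp K)))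
    (hbase : ∀ i : ℕ, i ≠ 1 → A i 0 = 0)
    (hfin : ∀ (i s : ℕ) (f : Rp K),
      (Set.Ici 1 ∩ Function.support fun n : ℕ =>
        (Jop K b ((i : ℤ) - (n : ℤ))) ((A n s) f)).Finite)
    (hrec : ∀ i : ℕ, 1 ≤ i → ∀ (s : ℕ) (f : Rp K),
      (A i (s + 1)) f =
        (∑ᶠ n ∈ Set.Ici (1 : ℕ), (Jop K b ((i : ℤ) - (n : ℤ))) ((A n s) f)) +
          (b * ((i : K) - 1)) • (A i s) f) :
    IsConstellation (1 + b) b (Jop K b) (extendByZero A) where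
  charge_ne_zero := hb
  J_zero := Jop_zero K b
  J_comm := Jop_comm b
  J_eventually := Jop_eventually b
  a_nonpos s i hi := extendByZero_nonpos A s hi
  a_zero_one f := by
    have h := extendByZero_natCast A 0 (le_refl 1)
    rw [Nat.cast_one] at h
    rw [h, hbase1, LinearMap.smul_apply, Module.End.one_apply, smul_inv_smul₀ hb]
  a_zero i hi := by
    by_cases h : 1 ≤ i
    · rw [extendByZero, if_pos h, hbase _ (by omega)]
    · exact extendByZero_nonpos A 0 (by omega)
  a_succ s i f hi := by
    lift i to ℕ using by omega
    have hi' : 1 ≤ i := by exact_mod_cast hi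
    refine (hasSum_int_iff_finsum (F := fun n : ℕ => Jop K b ((i : ℤ) - n) (A n s f))
      (fun n hn => ?_) fun n hn => ?_).2 ⟨?_, hfin i s f⟩
    · rw [extendByZero_nonpos A s hn, LinearMap.zero_apply, map_zero]
    · rw [extendByZero_natCast A s hn]
    · rw [extendByZero_natCast A _ hi', extendByZero_natCast A _ hi', hrec i hi', Int.cast_natCast,
        add_sub_cancel_right]

theorem pstar_eq_smul_Jop {K : Type} [Field K] {b : K} (hb : (1 : K) + b ≠ 0) {i : ℕ}
    (hi : 1 ≤ i) (f : Rp K) : pstar K i f = (1 + b)⁻¹ • Jop K b i f := by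
  rw [pstar, Jop, if_pos (by exact_mod_cast hi), Int.toNat_natCast, Int.cast_natCast,
    LinearMap.smul_apply, LinearMap.smul_apply, smul_smul, inv_mul_cancel_left₀ hb]

/--
**Commutation relations for the cubic `3`-constellation operators.**
Given the operators `A_i(s)` on `R = K[p₁, p₂, …]` determined by `A₁(0) = (1+b)⁻¹·id`,
`A_i(0) = 0` for `i ≠ 1`, and the (locally finite) recursion
`A_i(s+1) = Σ_{n≥1} J_{i−n} ∘ A_n(s) + b(i−1)·A_i(s)`,
one has for all `i, j ≥ 1` and `0 ≤ s, s' ≤ 3` (all sums over `l ≥ 1` being locally finite):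
(a) `[A_i(s), A_j(s)] = Σ_{l≥1} D_{ij,l}(s) ∘ A_l(s)`;
(b) `[A_i(s), A_j(s')] − [A_j(s), A_i(s')] = Σ_{l≥1} (D_{ij,l}(s') ∘ A_l(s) + D_{ij,l}(s) ∘ A_l(s'))`;
(c) `[p_i^*, A_j(s)] − [p_j^*, A_i(s)] = Σ_{l≥1} D_{ij,l}(s) ∘ p_l^*`.
-/
theorem stmt_10 {K : Type} [Field K] [CharZero K] (b : K) (hb : (1 : K) + b ≠ 0)
    (A : ℕ → ℕ → Module.End K (Rp K))
    (hbase1 : A 1 0 = ((1 : K) + b)⁻¹ • (1 : Module.End K (Rp K)))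
    (hbase : ∀ i : ℕ, i ≠ 1 → A i 0 = 0)
    (hfin : ∀ (i s : ℕ) (f : Rp K),
      (Set.Ici 1 ∩ Function.support fun n : ℕ =>
        (Jop K b ((i : ℤ) - (n : ℤ))) ((A n s) f)).Finite)
    (hrec : ∀ i : ℕ, 1 ≤ i → ∀ (s : ℕ) (f : Rp K),
      (A i (s + 1)) f =
        (∑ᶠ n ∈ Set.Ici (1 : ℕ), (Jop K b ((i : ℤ) - (n : ℤ))) ((A n s) f)) +
          (b * ((i : K) - 1)) • (A i s) f) :
    ∀ i j : ℕ, 1 ≤ i → 1 ≤ j →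
      (∀ s : ℕ, s ≤ 3 →
        (∀ f : Rp K, ⁅A i s, A j s⁆ f =
            ∑ᶠ l ∈ Set.Ici (1 : ℕ), (Dcoef K b i j l s) ((A l s) f)) ∧
        (∀ f : Rp K, (Set.Ici 1 ∩ Function.support fun l : ℕ =>
            (Dcoef K b i j l s) ((A l s) f)).Finite)) ∧
      (∀ s : ℕ, s ≤ 3 → ∀ s' : ℕ, s' ≤ 3 →
        (∀ f : Rp K, (⁅A i s, A j s'⁆ - ⁅A j s, A i s'⁆) f =
            ∑ᶠ l ∈ Set.Ici (1 : ℕ),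
              ((Dcoef K b i j l s') ((A l s) f) + (Dcoef K b i j l s) ((A l s') f))) ∧
        (∀ f : Rp K, (Set.Ici 1 ∩ Function.support fun l : ℕ =>
            (Dcoef K b i j l s') ((A l s) f) + (Dcoef K b i j l s) ((A l s') f)).Finite)) ∧
      (∀ s : ℕ, s ≤ 3 →
        (∀ f : Rp K, (⁅pstar K i, A j s⁆ - ⁅pstar K j, A i s⁆) f =
            ∑ᶠ l ∈ Set.Ici (1 : ℕ), (Dcoef K b i j l s) ((pstar K l) f)) ∧
        (∀ f : Rp K, (Set.Ici 1 ∩ Function.support fun l : ℕ =>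
            (Dcoef K b i j l s) ((pstar K l) f)).Finite)) := by
  let _ : TopologicalSpace (Rp K) := ⊥
  have : DiscreteTopology (Rp K) := ⟨rfl⟩
  have S := isConstellation_Jop b hb A hbase1 hbase hfin hrec
  intro i j hi hj
  have hi' : (1 : ℤ) ≤ i := by exact_mod_cast hi
  have hj' : (1 : ℤ) ≤ j := by exact_mod_cast hj
  have comm_a_a (s : ℕ) (hs : s ≤ 3) (s' : ℕ) (hs' : s' ≤ 3) (f : Rp K) :=
    S.hasSum_comm_a_a hi' hj' hs hs' f
  simp only [extendByZero_natCast A _ hi, extendByZero_natCast A _ hj] at comm_a_a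
  refine ⟨fun s hs => forall_and.1 fun f => ?_, fun s hs s' hs' => forall_and.1 fun f => ?_,
    fun s hs => forall_and.1 fun f => ?_⟩
  · have h := (comm_a_a s hs s hs f).smul_discrete (2 : K)⁻¹
    rw [← neg_sub (A i s (A j s f)) (A j s (A i s f)), sub_neg_eq_add, ← two_smul K,
      inv_smul_smul₀ two_ne_zero] at h
    refine (hasSum_int_iff_finsum (fun n hn => ?_) fun n hn => ?_).1 h
    · simp [extendByZero_nonpos A _ hn]
    · rw [extendByZero_natCast A _ hn, ← two_smul K, inv_smul_smul₀ two_ne_zero,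
        Dcoef_eq_structureOp]
  · refine (hasSum_int_iff_finsum (fun n hn => ?_) fun n hn => ?_).1 (comm_a_a s hs s' hs' f)
    · simp [extendByZero_nonpos A _ hn]
    · rw [extendByZero_natCast A _ hn, extendByZero_natCast A _ hn, Dcoef_eq_structureOp,
        Dcoef_eq_structureOp]
  · have h := (S.hasSum_comm_J_a hi' hj' hs f).smul_discrete (1 + b)⁻¹
    rw [extendByZero_natCast A _ hi, extendByZero_natCast A _ hj] at h
    have hv : (⁅pstar K i, A j s⁆ - ⁅pstar K j, A i s⁆) f = (1 + b)⁻¹ •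
        (Jop K b i (A j s f) - A j s (Jop K b i f) -
          (Jop K b j (A i s f) - A i s (Jop K b j f))) := by
      simp only [LinearMap.sub_apply, Ring.lie_def, Module.End.mul_apply,
        pstar_eq_smul_Jop hb hi, pstar_eq_smul_Jop hb hj, map_smul, smul_sub]
    rw [hv]
    refine (hasSum_int_iff_finsum (fun n hn => ?_) fun n hn => ?_).1 h
    · rw [if_neg (by omega), map_zero, smul_zero]
    · rw [if_pos (by exact_mod_cast hn), pstar_eq_smul_Jop hb hn, map_smul, Dcoef_eq_structureOp]
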